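/- Consider n coupled tasks with first sub-task of processing time a, idle time L = a + b, and second sub-task of processing time b, where a, b are natural numbers with 0 < b < a. In any valid schedule, if exactly two sub-task intervals of other tasks are contained in the idle interval [σ(i)+a, σ(i)+a+L) of a task i, then the first of them is a second sub-task (of length b) starting at time σ(i)+a and the other is a first sub-task (of length a) starting at time σ(i)+a+b. -/

import Mathlib

/-- The time interval occupied by a sub-task of a coupled task: `(i, true)` denotes the
first sub-task of task `i` (processing time `a`), `(i, false)` the second sub-task
(processing time `b`), which starts `L` time units after the completion of the first one. -/
def taskInterval (n a b L : ℕ) (σ : Fin n → ℕ) (q : Fin n × Bool) : Set ℕ :=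
  if q.2 then Set.Ico (σ q.1) (σ q.1 + a)
  else Set.Ico (σ q.1 + a + L) (σ q.1 + a + L + b)

/-- A schedule is valid when the `2n` sub-task intervals are pairwise disjoint. -/
def ValidSchedule (n a b L : ℕ) (σ : Fin n → ℕ) : Prop :=
  Pairwise fun q r : Fin n × Bool =>
    Disjoint (taskInterval n a b L σ q) (taskInterval n a b L σ r)

theorem ico_disj {x y c d : ℕ} (hc : 0 < c) (hd : 0 < d)
    (h : Disjoint (Set.Ico x (x + c)) (Set.Ico y (y + d))) : x + c ≤ y ∨ y + d ≤ x := by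
  rw [Set.disjoint_left] at h
  by_contra hh
  have := @h (max x y)
  simp only [Set.mem_Ico] at this
  omega

theorem ico_sub {x y c d : ℕ} (hc : 0 < c)
    (h : Set.Ico x (x + c) ⊆ Set.Ico y (y + d)) : y ≤ x ∧ x + c ≤ y + d := by
  have h1 := @h x
  have h2 := @h (x + c - 1)
  simp only [Set.mem_Ico] at h1 h2
  omega

theorem val_ft {n a b : ℕ} (hb : 0 < b) (hba : b < a) {σ : Fin n → ℕ}
    (hσ : ValidSchedule n a b (a + b) σ) {j k : Fin n} (hjk : j ≠ k) :
    σ j + a ≤ σ k ∨ σ k + a ≤ σ j := by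
  have h := @hσ (j, true) (k, true) (by simp [hjk])
  simp only [taskInterval, if_true] at h
  exact ico_disj (by omega) (by omega) h

theorem val_sf {n a b : ℕ} (hb : 0 < b) (hba : b < a) {σ : Fin n → ℕ}
    (hσ : ValidSchedule n a b (a + b) σ) (j k : Fin n) :
    σ j + a + (a + b) + b ≤ σ k ∨ σ k + a ≤ σ j + a + (a + b) := by
  have h := @hσ (j, false) (k, true) (by simp)
  simp only [taskInterval, if_true, Bool.false_eq_true, if_false] at h
  exact ico_disj (by omega) (by omega) h

theorem mixed_case {n a b : ℕ} (hb : 0 < b) (hba : b < a) {σ : Fin n → ℕ}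
    (hσ : ValidSchedule n a b (a + b) σ) {i j k : Fin n} (hj : j ≠ i) (hk : k ≠ i)
    (sj : taskInterval n a b (a + b) σ (j, false) ⊆ Set.Ico (σ i + a) (σ i + a + (a + b)))
    (sk : taskInterval n a b (a + b) σ (k, true) ⊆ Set.Ico (σ i + a) (σ i + a + (a + b))) :
    j ≠ k ∧ σ j + a + (a + b) = σ i + a ∧ σ k = σ i + a + b := by
  simp only [taskInterval, if_true, Bool.false_eq_true, if_false] at sj sk
  have h1 := ico_sub hb sj
  have h2 := ico_sub (by omega) sk
  have h3 := val_sf hb hba hσ j k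
  have h4 := val_ft hb hba hσ hj
  refine ⟨?_, ?_, ?_⟩
  · rintro rfl
    omega
  · omega
  · omega

/-- with `0 < b < a` and `L = a + b`, in any valid schedule, if exactly two
sub-task intervals of other tasks are contained in the idle interval
`[σ i + a, σ i + a + L)` of a task `i`, then the first one is a second sub-task (of
length `b`, of some task `j`) starting at time `σ i + a`, and the other is a first
sub-task (of length `a`, of some task `k`) starting at time `σ i + a + b`. -/
theorem stmt_16 (n a b : ℕ) (hb : 0 < b) (hba : b < a)
    (σ : Fin n → ℕ) (hσ : ValidSchedule n a b (a + b) σ) (i : Fin n)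
    (h2 : {q : Fin n × Bool | q.1 ≠ i ∧
      taskInterval n a b (a + b) σ q ⊆ Set.Ico (σ i + a) (σ i + a + (a + b))}.ncard = 2) :
    ∃ j k : Fin n, j ≠ i ∧ k ≠ i ∧ j ≠ k ∧
      {q : Fin n × Bool | q.1 ≠ i ∧
        taskInterval n a b (a + b) σ q ⊆ Set.Ico (σ i + a) (σ i + a + (a + b))} =
        {(j, false), (k, true)} ∧
      σ j + a + (a + b) = σ i + a ∧ σ k = σ i + a + b := by
  obtain ⟨⟨j, p⟩, ⟨k, q⟩, hne, hS⟩ := Set.ncard_eq_two.mp h2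
  have hj : (j, p) ∈ ({(j, p), (k, q)} : Set (Fin n × Bool)) := by simp
  have hk : (k, q) ∈ ({(j, p), (k, q)} : Set (Fin n × Bool)) := by simp
  rw [← hS] at hj hk
  obtain ⟨hji, sj⟩ := hj
  obtain ⟨hki, sk⟩ := hk
  simp only at hji hki
  cases p <;> cases q
  · exfalso
    have hjk : j ≠ k := fun h => hne (by rw [h])
    simp only [taskInterval, Bool.false_eq_true, if_false] at sj sk
    have h1 := ico_sub hb sj
    have h2 := ico_sub hb sk
    have h3 := val_ft hb hba hσ hjk
    have h4 := val_ft hb hba hσ hji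
    have h5 := val_ft hb hba hσ hki
    omega
  · obtain ⟨h1, h2, h3⟩ := mixed_case hb hba hσ hji hki sj sk
    exact ⟨j, k, hji, hki, h1, hS, h2, h3⟩
  · obtain ⟨h1, h2, h3⟩ := mixed_case hb hba hσ hki hji sk sj
    exact ⟨k, j, hki, hji, h1, by rw [hS, Set.pair_comm], h2, h3⟩
  · exfalso
    have hjk : j ≠ k := fun h => hne (by rw [h])
    simp only [taskInterval, if_true] at sj sk
    have h1 := ico_sub (by omega) sj
    have h2 := ico_sub (by omega) sk
    have h3 := val_ft hb hba hσ hjk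
    omega
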